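/- (Regret bound for policy orchestration.) Let Π = (π_1, …, π_K) be K ≥ 2 expert policies, let q_1, …, q_T be state-dependent weight vectors over [K], and let B > 0 be such that for every state s ∈ S: max_{k∈[K]} ∑_{t=1}^T A_{q_tΠ}(s,k) ≤ B/(1−γ). Then for every state-dependent weight vector q over [K] and every state s1 ∈ S: ∑_{t=1}^T (V_{qΠ}(s1) − V_{q_tΠ}(s1)) ≤ B/(1−γ)². -/

import Mathlib

open Finset

/-- The mixture policy `qΠ(a|s) = ∑_k q(k|s) π_k(a|s)` induced by state-dependent weights
`q` over `K` expert policies. -/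
noncomputable def mixPolicy {S A : Type*} {K : ℕ}
    (experts : Fin K → S → A → ℝ) (q : S → Fin K → ℝ) : S → A → ℝ :=
  fun s a => ∑ k, q s k * experts k s a

theorem sum_mixPolicy_mul {S A : Type*} [Fintype A] {K : ℕ} (experts : Fin K → S → A → ℝ)
    (q : S → Fin K → ℝ) (s : S) (f : A → ℝ) :
    ∑ a, mixPolicy experts q s a * f a = ∑ k, q s k * ∑ a, experts k s a * f a := by
  simp only [mixPolicy, sum_mul, mul_sum, mul_assoc]
  exact sum_comm

theorem mixPolicy_nonneg {S A : Type*} {K : ℕ} {experts : Fin K → S → A → ℝ}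
    {q : S → Fin K → ℝ} (hexp : ∀ k s a, 0 ≤ experts k s a) (hq : ∀ s k, 0 ≤ q s k)
    (s : S) (a : A) : 0 ≤ mixPolicy experts q s a :=
  sum_nonneg fun k _ => mul_nonneg (hq s k) (hexp k s a)

theorem sum_mixPolicy {S A : Type*} [Fintype A] {K : ℕ} {experts : Fin K → S → A → ℝ}
    {q : S → Fin K → ℝ} (hexp : ∀ k s, ∑ a, experts k s a = 1) (hq : ∀ s, ∑ k, q s k = 1)
    (s : S) : ∑ a, mixPolicy experts q s a = 1 := by
  simpa [hexp, hq] using sum_mixPolicy_mul experts q s fun _ => 1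

/-- A function that is at most a constant plus its discounted one-step expectation is bounded by
the discounted sum of that constant. -/
theorem le_div_one_sub_of_le_add_discounted {S A : Type*} [Fintype S] [Fintype A]
    {T : S → A → S → ℝ} (hT0 : ∀ s a s', 0 ≤ T s a s') (hT1 : ∀ s a, ∑ s', T s a s' = 1)
    {π : S → A → ℝ} (hπ0 : ∀ s a, 0 ≤ π s a) (hπ1 : ∀ s, ∑ a, π s a = 1)
    {γ : ℝ} (hγ0 : 0 ≤ γ) (hγ1 : γ < 1) {f : S → ℝ} {C : ℝ}
    (hf : ∀ s, f s ≤ C + γ * ∑ a, π s a * ∑ s', T s a s' * f s') (s : S) :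
    f s ≤ C / (1 - γ) := by
  have : Nonempty S := ⟨s⟩
  obtain ⟨m, hm⟩ := Finite.exists_max f
  have hT (a : A) : ∑ s', T m a s' * f s' ≤ f m := by
    calc ∑ s', T m a s' * f s' ≤ ∑ s', T m a s' * f m :=
          sum_le_sum fun s' _ => mul_le_mul_of_nonneg_left (hm s') (hT0 m a s')
      _ = f m := by rw [← sum_mul, hT1, one_mul]
  have hπ : ∑ a, π m a * ∑ s', T m a s' * f s' ≤ f m := by
    calc ∑ a, π m a * ∑ s', T m a s' * f s' ≤ ∑ a, π m a * f m :=
          sum_le_sum fun a _ => mul_le_mul_of_nonneg_left (hT a) (hπ0 m a)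
      _ = f m := by rw [← sum_mul, hπ1, one_mul]
  refine (hm s).trans ((le_div_iff₀ (sub_pos.2 hγ1)).2 ?_)
  linarith [hf m, mul_le_mul_of_nonneg_left hπ hγ0]

/-- One-step form of the performance difference lemma: the gap between the value function `V` of
a policy and any function `W` is the expected advantage with respect to `W` plus the discounted
expected gap at the next state. -/
theorem value_sub_eq_advantage_add {S A : Type*} [Fintype S] [Fintype A]
    {T : S → A → S → ℝ} {r : S → A → ℝ} {γ : ℝ}
    {π : S → A → ℝ} (hπ1 : ∀ s, ∑ a, π s a = 1) {V : S → ℝ}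
    (hV : ∀ s, V s = ∑ a, π s a * (r s a + γ * ∑ s', T s a s' * V s')) (W : S → ℝ) (s : S) :
    V s - W s = ∑ a, π s a * ((r s a + γ * ∑ s', T s a s' * W s') - W s)
      + γ * ∑ a, π s a * ∑ s', T s a s' * (V s' - W s') := by
  have hW : W s = ∑ a, π s a * W s := by rw [← sum_mul, hπ1, one_mul]
  conv_lhs => rw [hV s, hW]
  rw [mul_sum, ← sum_sub_distrib, ← sum_add_distrib]
  refine sum_congr rfl fun a _ => ?_
  simp only [mul_sub, sum_sub_distrib]
  ring

/-- Regret bound for policy orchestration: if for every state `s`,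
`max_k ∑_{t=1}^T A_{q_tΠ}(s,k) ≤ B/(1−γ)`, then for every state-dependent weight vector `q⋆`
and every state `s1`, `∑_{t=1}^T (V_{q⋆Π}(s1) − V_{q_tΠ}(s1)) ≤ B/(1−γ)²`.
Here `A_{π'}(s,k) = ∑_a π_k(a|s) A_{π'}(s,a)` with
`A_{π'}(s,a) = r(s,a) + γ ∑_{s'} T(s'|s,a) V_{π'}(s') − V_{π'}(s)`. -/
theorem orchestration_regret_bound
    {S A : Type*} [Fintype S] [Fintype A] [Nonempty S] [Nonempty A]
    (T : S → A → S → ℝ) (hT0 : ∀ s a s', 0 ≤ T s a s')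
    (hT1 : ∀ s a, ∑ s', T s a s' = 1)
    (r : S → A → ℝ) (hr0 : ∀ s a, 0 ≤ r s a) (hr1 : ∀ s a, r s a ≤ 1)
    (γ : ℝ) (hγ0 : 0 < γ) (hγ1 : γ < 1)
    (K : ℕ) (hK : 2 ≤ K)
    (experts : Fin K → S → A → ℝ)
    (hexp0 : ∀ k s a, 0 ≤ experts k s a)
    (hexp1 : ∀ k s, ∑ a, experts k s a = 1)
    (Tn : ℕ)
    (q : Fin Tn → S → Fin K → ℝ)
    (hq0 : ∀ t s k, 0 ≤ q t s k) (hq1 : ∀ t s, ∑ k, q t s k = 1)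
    (V : Fin Tn → S → ℝ)
    (hV : ∀ t s, V t s
      = ∑ a, mixPolicy experts (q t) s a * (r s a + γ * ∑ s', T s a s' * V t s'))
    (B : ℝ) (hB : 0 < B)
    (hadv : ∀ s k, ∑ t, (∑ a, experts k s a *
        ((r s a + γ * ∑ s', T s a s' * V t s') - V t s)) ≤ B / (1 - γ))
    (qstar : S → Fin K → ℝ)
    (hqs0 : ∀ s k, 0 ≤ qstar s k) (hqs1 : ∀ s, ∑ k, qstar s k = 1)
    (Vstar : S → ℝ)
    (hVstar : ∀ s, Vstar s
      = ∑ a, mixPolicy experts qstar s a * (r s a + γ * ∑ s', T s a s' * Vstar s'))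
    (s1 : S) :
    ∑ t, (Vstar s1 - V t s1) ≤ B / (1 - γ) ^ 2 := by
  have hπ0 := mixPolicy_nonneg hexp0 hqs0
  have hπ1 := sum_mixPolicy hexp1 hqs1
  rw [sq, ← div_div]
  refine le_div_one_sub_of_le_add_discounted (f := fun s => ∑ t, (Vstar s - V t s))
    hT0 hT1 hπ0 hπ1 hγ0.le hγ1 (fun s => ?_) s1
  have hgap : ∑ t, γ * ∑ a, mixPolicy experts qstar s a * ∑ s', T s a s' * (Vstar s' - V t s')
      = γ * ∑ a, mixPolicy experts qstar s a * ∑ s', T s a s' * ∑ t, (Vstar s' - V t s') := by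
    rw [← mul_sum, sum_comm]
    simp only [← mul_sum]
    congr 1
    refine sum_congr rfl fun a _ => ?_
    rw [sum_comm]
    simp only [← mul_sum]
  simp only [value_sub_eq_advantage_add hπ1 hVstar (V _) s, sum_add_distrib]
  rw [hgap]
  gcongr
  simp only [sum_mixPolicy_mul]
  rw [sum_comm]
  simp only [← mul_sum]
  calc _ ≤ ∑ k, qstar s k * (B / (1 - γ)) :=
        sum_le_sum fun k _ => mul_le_mul_of_nonneg_left (hadv s k) (hqs0 s k)
    _ = B / (1 - γ) := by rw [← sum_mul, hqs1, one_mul]
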